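/- arXiv:1810.04163 — 3 statements merged into one kernel-verified Lean document; each statement's English description precedes it below -/
import Mathlib

section
/- Let H be a real inner product space, C > 0, Δt > 0, M ∈ ℝ, and let p, z', w, φ, b, b₋, ζ ∈ H satisfy (F): C‖p‖² + Δt⟨z', p⟩ + ⟨φ, p⟩ = −(C/3)⟨b₋, p⟩; (D): ‖w‖² = ⟨p, z'⟩; (P): M + (C/3)⟨b, p⟩ = 0; and (Z): ζ = C p + (C/3) b + φ. Then C‖p‖² + Δt‖w‖² + M + (1/(2C))‖ζ‖² − (C/2)‖p‖² − (C/18)‖b‖² − (1/(2C))‖φ‖² − (1/3)⟨b, φ⟩ = −(C/3)⟨b₋, p⟩. -/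
open RealInnerProductSpace

/-- Combining the tested flow equation (F), the tested Darcy law (D), the tested
poromechanics equation (P) and the fluid-content relation (Z) in the
fixed-stress split scheme. -/
theorem combine_flow_darcy_poromech
    (H : Type*) [NormedAddCommGroup H] [InnerProductSpace ℝ H]
    (C Δt M : ℝ) (hC : 0 < C) (hΔt : 0 < Δt)
    (p z' w φ b bm ζ : H)
    (hF : C * ‖p‖ ^ 2 + Δt * ⟪z', p⟫ + ⟪φ, p⟫ = -(C / 3) * ⟪bm, p⟫)
    (hD : ‖w‖ ^ 2 = ⟪p, z'⟫)
    (hP : M + (C / 3) * ⟪b, p⟫ = 0)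
    (hZ : ζ = C • p + (C / 3) • b + φ) :
    C * ‖p‖ ^ 2 + Δt * ‖w‖ ^ 2 + M + (1 / (2 * C)) * ‖ζ‖ ^ 2
      - (C / 2) * ‖p‖ ^ 2 - (C / 18) * ‖b‖ ^ 2 - (1 / (2 * C)) * ‖φ‖ ^ 2
      - (1 / 3) * ⟪b, φ⟫
      = -(C / 3) * ⟪bm, p⟫ := by
  have hζ : (1 / (2 * C)) * ‖ζ‖ ^ 2 = (C / 2) * ‖p‖ ^ 2 + (C / 18) * ‖b‖ ^ 2
      + (1 / (2 * C)) * ‖φ‖ ^ 2 + (C / 3) * ⟪b, p⟫ + ⟪φ, p⟫ + (1 / 3) * ⟪b, φ⟫ := by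
    simp only [hZ, ← real_inner_self_eq_norm_sq, inner_add_left, inner_add_right,
      real_inner_smul_left, real_inner_smul_right]
    rw [real_inner_comm b p, real_inner_comm φ p, real_inner_comm φ b]
    field_simp
    ring
  rw [real_inner_comm] at hD
  rw [hζ, hD]
  linarith
end

section
/- Let H be a real inner product space, C > 0, Δt > 0, M ∈ ℝ, and let p, z', w, φ, b, b₋, ζ ∈ H satisfy (F): C‖p‖² + Δt⟨z', p⟩ + ⟨φ, p⟩ = −(C/3)⟨b₋, p⟩; (D): ‖w‖² = ⟨p, z'⟩; (P): M + (C/3)⟨b, p⟩ = 0; and (Z): ζ = C p + (C/3) b + φ. Then (C/3)‖p‖² + Δt‖w‖² + M + (1/(2C))‖ζ‖² − (1/(2C))‖ζ − C p‖² ≤ (C/6)‖b₋‖². -/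
open RealInnerProductSpace

/-- Contraction-type estimate obtained by combining the tested flow equation (F),
the tested Darcy law (D), the tested poromechanics equation (P) and the
fluid-content relation (Z) with Young's inequality applied to `−(C/3)⟨b₋,p⟩`. -/
theorem contraction_estimate
    (H : Type*) [NormedAddCommGroup H] [InnerProductSpace ℝ H]
    (C Δt M : ℝ) (hC : 0 < C) (hΔt : 0 < Δt)
    (p z' w φ b bm ζ : H)
    (hF : C * ‖p‖ ^ 2 + Δt * ⟪z', p⟫ + ⟪φ, p⟫ = -(C / 3) * ⟪bm, p⟫)
    (hD : ‖w‖ ^ 2 = ⟪p, z'⟫)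
    (hP : M + (C / 3) * ⟪b, p⟫ = 0)
    (hZ : ζ = C • p + (C / 3) • b + φ) :
    (C / 3) * ‖p‖ ^ 2 + Δt * ‖w‖ ^ 2 + M + (1 / (2 * C)) * ‖ζ‖ ^ 2
      - (1 / (2 * C)) * ‖ζ - C • p‖ ^ 2
      ≤ (C / 6) * ‖bm‖ ^ 2 := by
  have hpolar : (1 / (2 * C)) * ‖ζ‖ ^ 2 - (1 / (2 * C)) * ‖ζ - C • p‖ ^ 2
      = ⟪ζ, p⟫ - C / 2 * ‖p‖ ^ 2 := by
    rw [norm_sub_sq_real, inner_smul_right, norm_smul, mul_pow, Real.norm_eq_abs, sq_abs]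
    field_simp
    ring
  have hζp : ⟪ζ, p⟫ = C * ‖p‖ ^ 2 + C / 3 * ⟪b, p⟫ + ⟪φ, p⟫ := by
    rw [hZ, inner_add_left, inner_add_left, real_inner_smul_left, real_inner_smul_left,
      real_inner_self_eq_norm_sq]
  have hyoung : 0 ≤ C / 6 * (‖bm‖ ^ 2 + 2 * ⟪bm, p⟫ + ‖p‖ ^ 2) := by
    rw [← norm_add_sq_real]
    positivity
  rw [real_inner_comm] at hD
  rw [hD]
  linarith
end

section
/- Let H be a real inner product space, C > 0, Δt > 0, M ∈ ℝ, and let p, z', w, φ, φ_f, b, b₋, ζ, ζ_f ∈ H satisfy (F): C‖p‖² + Δt⟨z', p⟩ + ⟨φ, p⟩ = −(C/3)⟨b₋, p⟩; (D): ‖w‖² = ⟨p, z'⟩; (P): M + (C/3)⟨b, p⟩ = 0; (Z): ζ = C p + (C/3) b + φ; and (Zf): ζ_f = C p + φ_f. Then (C/6)‖b‖² + (C/3)‖p‖² + Δt‖w‖² + M + (1/(2C))‖ζ‖² + (2/C)‖φ − φ_f‖² − [ (2/C)‖ζ − ζ_f‖² + (1/(2C))‖φ‖² + (4/3)⟨b,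 φ_f⟩ − ⟨b, φ⟩ ] ≤ (C/6)‖b₋‖². -/
open RealInnerProductSpace

/-- Contraction statement of Theorem 1 of the paper (with coefficients corrected
so that the inequality is an algebraic consequence of the hypotheses): the
fixed-stress split scheme for small-strain anisotropic poroelastoplasticity
contracts in the quantity `(C/6)‖B:δσ‖²` modulo the bracketed plasticity terms,
which are driven to zero by the convergence criterion. -/
theorem fixed_stress_contraction
    (H : Type*) [NormedAddCommGroup H] [InnerProductSpace ℝ H]
    (C Δt M : ℝ) (hC : 0 < C) (hΔt : 0 < Δt)
    (p z' w φ φf b bm ζ ζf : H)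
    (hF : C * ‖p‖ ^ 2 + Δt * ⟪z', p⟫ + ⟪φ, p⟫ = -(C / 3) * ⟪bm, p⟫)
    (hD : ‖w‖ ^ 2 = ⟪p, z'⟫)
    (hP : M + (C / 3) * ⟪b, p⟫ = 0)
    (hZ : ζ = C • p + (C / 3) • b + φ)
    (hZf : ζf = C • p + φf) :
    (C / 6) * ‖b‖ ^ 2 + (C / 3) * ‖p‖ ^ 2 + Δt * ‖w‖ ^ 2 + M
      + (1 / (2 * C)) * ‖ζ‖ ^ 2 + (2 / C) * ‖φ - φf‖ ^ 2
      - ((2 / C) * ‖ζ - ζf‖ ^ 2 + (1 / (2 * C)) * ‖φ‖ ^ 2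
          + (4 / 3) * ⟪b, φf⟫ - ⟪b, φ⟫)
      ≤ (C / 6) * ‖bm‖ ^ 2 := by
  have hζ : (1 / (2 * C)) * ‖ζ‖ ^ 2 = C / 2 * ‖p‖ ^ 2 + C / 18 * ‖b‖ ^ 2
      + (1 / (2 * C)) * ‖φ‖ ^ 2 + C / 3 * ⟪b, p⟫ + ⟪φ, p⟫ + 1 / 3 * ⟪b, φ⟫ := by
    rw [hZ, norm_add_sq_real, norm_add_sq_real, inner_add_left]
    simp only [norm_smul, mul_pow, Real.norm_eq_abs, sq_abs, real_inner_smul_left,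
      real_inner_smul_right]
    rw [real_inner_comm b p, real_inner_comm φ p]
    field_simp
    ring
  have hζf : (2 / C) * ‖ζ - ζf‖ ^ 2 = 2 * C / 9 * ‖b‖ ^ 2 + (2 / C) * ‖φ - φf‖ ^ 2
      + 4 / 3 * ⟪b, φ⟫ - 4 / 3 * ⟪b, φf⟫ := by
    have hdiff : ζ - ζf = (C / 3) • b + (φ - φf) := by rw [hZ, hZf]; abel
    rw [hdiff, norm_add_sq_real, real_inner_smul_left, inner_sub_right, norm_smul, mul_pow,
      Real.norm_eq_abs, sq_abs]
    field_simp
    ring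
  have hsq : 0 ≤ C / 6 * (‖bm‖ ^ 2 + 2 * ⟪bm, p⟫ + ‖p‖ ^ 2) := by
    rw [← norm_add_sq_real]
    positivity
  rw [real_inner_comm] at hD
  rw [← hD] at hF
  linarith
end
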